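/- Let X be a nonempty topological space equipped with a finite Borel measure μ with full support (every nonempty open set has positive measure). Let H be a nonempty subset of the space of bounded continuous real-valued functions on X, compact with respect to the supremum norm and upwards directed, and let f̂ ∈ H. Define ub(x) := sup_{f ∈ H} f(x). Then for every strictly increasing continuous function u : ℝ → ℝ, the function ub belongs to H and is the unique maximizer over h ∈ H of the functional h ↦ ∫_X u(h(x) − f̂(x)) dμ(x). -/

import Mathlib

open MeasureTheory

/-- A nonempty compact directed set has a greatest element. -/
theorem IsCompact.exists_isGreatest_of_directedOn {α : Type*} [TopologicalSpace α] [Preorder α]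
    [ClosedIciTopology α] {s : Set α} (hs : IsCompact s) (hne : s.Nonempty)
    (hdir : DirectedOn (· ≤ ·) s) : ∃ a, IsGreatest s a := by
  have : Nonempty s := hne.to_subtype
  obtain ⟨a, has, ha⟩ := hs.inter_iInter_nonempty (fun i : s ↦ Set.Ici (i : α))
    (fun _ ↦ isClosed_Ici) fun t ↦ by
      obtain ⟨m, hm⟩ := hdir.directed_val.finset_le t
      exact ⟨m, m.2, Set.mem_iInter₂.2 hm⟩
  exact ⟨a, has, fun b hb ↦ Set.mem_iInter.1 ha ⟨b, hb⟩⟩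

/-- A continuous function of a bounded continuous function is integrable for a finite measure. -/
theorem Continuous.integrable_comp_boundedContinuousFunction {X : Type*} [TopologicalSpace X]
    [MeasurableSpace X] [OpensMeasurableSpace X] {μ : Measure X} [IsFiniteMeasure μ]
    {u : ℝ → ℝ} (hu : Continuous u) (f : BoundedContinuousFunction X ℝ) :
    Integrable (fun x ↦ u (f x)) μ := by
  obtain ⟨C, hC⟩ := (isCompact_closedBall (0 : ℝ) ‖f‖).exists_bound_of_continuousOn
    hu.continuousOn
  exact .of_bound (hu.comp f.continuous).aestronglyMeasurable C
    (.of_forall fun x ↦ hC _ (by simpa using f.norm_coe_le_norm x))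

/-- Theorem 2 (general version): for a nonempty topological space `X` with a finite Borel
measure `μ` of full support, `H` a nonempty compact (sup-norm) upwards directed set of
bounded continuous functions and `f̂ ∈ H`, the pointwise supremum `ub` belongs to `H` and is
the unique maximizer of `h ↦ ∫ u (h x - f̂ x) dμ` for every strictly increasing continuous `u`. -/
theorem stmt1 {X : Type*} [TopologicalSpace X] [MeasurableSpace X] [BorelSpace X]
    [Nonempty X] (μ : Measure X) [IsFiniteMeasure μ] [μ.IsOpenPosMeasure]
    (H : Set (BoundedContinuousFunction X ℝ)) (hne : H.Nonempty) (hcomp : IsCompact H)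
    (hdir : ∀ f₁ ∈ H, ∀ f₂ ∈ H, ∃ f ∈ H, ∀ x, max (f₁ x) (f₂ x) ≤ f x)
    (fhat : BoundedContinuousFunction X ℝ) (hfhat : fhat ∈ H)
    (u : ℝ → ℝ) (hu : StrictMono u) (hucont : Continuous u) :
    ∃ ub ∈ H,
      (∀ x, ub x = ⨆ f : H, (f : BoundedContinuousFunction X ℝ) x) ∧
      (∀ h ∈ H, ∫ x, u (h x - fhat x) ∂μ ≤ ∫ x, u (ub x - fhat x) ∂μ) ∧
      (∀ h ∈ H, (∫ x, u (h x - fhat x) ∂μ) = (∫ x, u (ub x - fhat x) ∂μ) → h = ub) := by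
  obtain ⟨ub, hub, hmax⟩ := hcomp.exists_isGreatest_of_directedOn hne fun f₁ h₁ f₂ h₂ ↦ by
    obtain ⟨f, hf, hle⟩ := hdir f₁ h₁ f₂ h₂
    exact ⟨f, hf, fun x ↦ (le_max_left _ _).trans (hle x), fun x ↦ (le_max_right _ _).trans (hle x)⟩
  have hint (h : BoundedContinuousFunction X ℝ) : Integrable (fun x ↦ u (h x - fhat x)) μ :=
    hucont.integrable_comp_boundedContinuousFunction (h - fhat)
  have hle (h : BoundedContinuousFunction X ℝ) (hh : h ∈ H) (x : X) :
      u (h x - fhat x) ≤ u (ub x - fhat x) :=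
    hu.monotone (sub_le_sub_right (hmax hh x) _)
  refine ⟨ub, hub, fun x ↦ ?_, fun h hh ↦ integral_mono (hint h) (hint ub) (hle h hh),
    fun h hh heq ↦ ?_⟩
  · have hgreatest : IsGreatest (Set.range fun f : H ↦ (f : BoundedContinuousFunction X ℝ) x)
        (ub x) :=
      ⟨⟨⟨ub, hub⟩, rfl⟩, Set.forall_mem_range.2 fun f ↦ hmax f.2 x⟩
    exact hgreatest.csSup_eq.symm
  · have hae := (integral_eq_iff_of_ae_le (hint h) (hint ub) (.of_forall (hle h hh))).1 heq
    have hfun := (Continuous.ae_eq_iff_eq μ (by fun_prop) (by fun_prop)).1 hae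
    ext x
    exact sub_left_injective (hu.injective (congrFun hfun x))
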